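/- The non-cooperative Nash rational synthesis (NCNS) problem for quantitative reachability games with integer weights is undecidable: there is no algorithm that, given a finite quantitative reachability game whose weight functions take values in ℤ, an initial vertex v_0, and a threshold c ∈ ℕ, decides whether there exists a strategy σ_0 of player 0 such that every σ_0-fixed Nash equilibrium outcome π satisfies cost_0(π) ≤ c. Formally, under a natural effective encoding of such finite instances as natural numbers, the set of encodings of positive instances is not a decidable (computable) set. -/

import Mathlib

open scoped Classical

/-- An infinite play in the graph with edge relation `E`. -/
def IsPlay {V : Type*} (E : V → V → Prop) (π : ℕ → V) : Prop :=
  ∀ k, E (π k) (π (k + 1))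

/-- The history `π 0, …, π k` as a list. -/
def histList {V : Type*} (π : ℕ → V) (k : ℕ) : List V :=
  (List.range (k + 1)).map π

/-- The cost (in `ℤ ∪ {+∞}`) of a play for the integer weight function `w` and the
target set `T`: the accumulated weight up to the first visit of `T`, and `+∞` if `T`
is never visited. -/
noncomputable def costZ {V : Type*} (w : V → V → ℤ) (T : Set V) (π : ℕ → V) :
    WithTop ℤ :=
  if h : ∃ n, π n ∈ T then
    ((∑ j ∈ Finset.range (Nat.find h), w (π j) (π (j + 1)) : ℤ) : WithTop ℤ)
  else ⊤

/-- `σ` is a strategy for player `i` in a game where `own v` is the owner of `v`. -/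
def IsStrategyFor {V P : Type*} (E : V → V → Prop) (own : V → P) (i : P)
    (σ : List V → V) : Prop :=
  ∀ (l : List V) (u : V), List.Chain' E (l ++ [u]) → own u = i → E u (σ (l ++ [u]))

/-- A play is the outcome of the strategy profile `σ`: at each step the owner's
strategy chooses the next vertex. -/
def ProfConsistent {V P : Type*} (own : V → P) (σ : P → List V → V)
    (π : ℕ → V) : Prop :=
  ∀ k, π (k + 1) = σ (own (π k)) (histList π k)

/-- `σ` is a `σ 0`-fixed Nash equilibrium with outcome `π` from `v0` (with integer
weights): no player `i ≠ 0` can strictly decrease his cost by deviating. -/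
def IsNEZ {V : Type*} {t : ℕ} (E : V → V → Prop) (own : V → Fin (t + 1))
    (w : Fin (t + 1) → V → V → ℤ) (T : Fin (t + 1) → Set V) (v0 : V)
    (σ : Fin (t + 1) → List V → V) (π : ℕ → V) : Prop :=
  (∀ i, IsStrategyFor E own i (σ i)) ∧ IsPlay E π ∧ π 0 = v0 ∧
    ProfConsistent own σ π ∧
    ∀ i : Fin (t + 1), i ≠ 0 → ∀ τ : List V → V, IsStrategyFor E own i τ →
      ∀ π' : ℕ → V, IsPlay E π' → π' 0 = v0 →
        ProfConsistent own (Function.update σ i τ) π' →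
        costZ (w i) (T i) π ≤ costZ (w i) (T i) π'

/-- A finite instance of the non-cooperative Nash rational synthesis problem with
integer weights: `n` vertices `0, …, n-1`, players `0, …, t`, a list of edges, a
list giving the owner of each vertex, for each player a list of weighted edges and a
list giving his target set, an initial vertex and a threshold. -/
structure NCNSInstance where
  n : ℕ
  t : ℕ
  edges : List (ℕ × ℕ)
  own : List ℕ
  w : List (List (ℕ × ℕ × ℤ))
  tgt : List (List ℕ)
  v0 : ℕ
  c : ℕ

namespace NCNSInstance

/-- A natural effective encoding of instances. -/
def encEquiv : NCNSInstance ≃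
    ℕ × ℕ × List (ℕ × ℕ) × List ℕ × List (List (ℕ × ℕ × ℤ)) × List (List ℕ) × ℕ × ℕ where
  toFun I := (I.n, I.t, I.edges, I.own, I.w, I.tgt, I.v0, I.c)
  invFun p := ⟨p.1, p.2.1, p.2.2.1, p.2.2.2.1, p.2.2.2.2.1, p.2.2.2.2.2.1,
    p.2.2.2.2.2.2.1, p.2.2.2.2.2.2.2⟩
  left_inv I := rfl
  right_inv p := rfl

instance : Primcodable NCNSInstance := Primcodable.ofEquiv _ encEquiv

/-- The edge relation of the instance, on the vertex set `Fin I.n`. -/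
def Edge (I : NCNSInstance) (u v : Fin I.n) : Prop :=
  ((u : ℕ), (v : ℕ)) ∈ I.edges

/-- The owner of a vertex. -/
def owner (I : NCNSInstance) (v : Fin I.n) : Fin (I.t + 1) :=
  ⟨I.own.getD (v : ℕ) 0 % (I.t + 1), Nat.mod_lt _ (Nat.succ_pos I.t)⟩

/-- The weight function of player `i`. -/
def weight (I : NCNSInstance) (i : Fin (I.t + 1)) (u v : Fin I.n) : ℤ :=
  (((I.w.getD (i : ℕ) []).filter fun p => p.1 == (u : ℕ) && p.2.1 == (v : ℕ)).map
    fun p => p.2.2).sum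

/-- The target set of player `i`. -/
def target (I : NCNSInstance) (i : Fin (I.t + 1)) : Set (Fin I.n) :=
  {v | (v : ℕ) ∈ I.tgt.getD (i : ℕ) []}

/-- The instance is positive: it is well formed (the initial vertex exists and every
vertex has a successor) and there is a strategy `σ0` of player 0 such that every
`σ0`-fixed Nash equilibrium outcome `π` satisfies `cost₀ π ≤ c`. -/
def Positive (I : NCNSInstance) : Prop :=
  ∃ h0 : I.v0 < I.n,
    (∀ u : Fin I.n, ∃ v : Fin I.n, I.Edge u v) ∧
    ∃ σ0 : List (Fin I.n) → Fin I.n, IsStrategyFor I.Edge I.owner 0 σ0 ∧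
      ∀ (σ : Fin (I.t + 1) → List (Fin I.n) → Fin I.n) (π : ℕ → Fin I.n),
        σ 0 = σ0 → IsNEZ I.Edge I.owner I.weight I.target ⟨I.v0, h0⟩ σ π →
        costZ (I.weight 0) (I.target 0) π ≤ ((I.c : ℤ) : WithTop ℤ)

end NCNSInstance

/-! ### Counter programs -/

/-- Programs over registers indexed by `ℕ`; `loop a p` decrements `a` and runs `p` as long as
`a` is nonzero. -/
inductive CProg
  | skip
  | inc (a : ℕ)
  | seq (p q : CProg)
  | loop (a : ℕ) (p : CProg)

namespace CProg

open Function

/-- Big-step semantics of counter programs. -/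
inductive Ev : CProg → (ℕ → ℕ) → (ℕ → ℕ) → Prop
  | skip (s) : Ev skip s s
  | inc (a s) : Ev (inc a) s (update s a (s a + 1))
  | seq {p q s s' s''} : Ev p s s' → Ev q s' s'' → Ev (seq p q) s s''
  | loop_zero {a p s} : s a = 0 → Ev (loop a p) s s
  | loop_succ {a p s s' s'' n} : s a = n + 1 → Ev p (update s a n) s' →
      Ev (loop a p) s' s'' → Ev (loop a p) s s''

theorem Ev.congr {p : CProg} {s t t' : ℕ → ℕ} (h : Ev p s t) (ht : t = t') : Ev p s t' :=
  ht ▸ h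

theorem Ev.deterministic {p : CProg} {s t t' : ℕ → ℕ} (h : Ev p s t) (h' : Ev p s t') :
    t = t' := by
  induction h generalizing t' with
  | skip s => cases h'; rfl
  | inc a s => cases h'; rfl
  | seq _ _ ih₁ ih₂ =>
    cases h' with
    | seq h₁ h₂ => rw [← ih₁ h₁] at h₂; exact ih₂ h₂
  | loop_zero h =>
    cases h' with
    | loop_zero _ => rfl
    | loop_succ e _ _ => omega
  | loop_succ e _ _ ih₁ ih₂ =>
    cases h' with
    | loop_zero _ => omega
    | loop_succ e' h₁ h₂ =>
      obtain rfl : _ = _ := Nat.succ.inj (e.symm.trans e')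
      rw [← ih₁ h₁] at h₂; exact ih₂ h₂

/-- A loop whose counter is `k` in the state `S k` and whose body leads from `S (k + 1)` with the
counter decremented to `S k`. -/
theorem Ev.loop_family {a : ℕ} {p : CProg} (S : ℕ → ℕ → ℕ) (n : ℕ) (hS : ∀ k ≤ n, S k a = k)
    (hp : ∀ k < n, Ev p (update (S (k + 1)) a k) (S k)) : Ev (loop a p) (S n) (S 0) := by
  induction n with
  | zero => exact .loop_zero (hS 0 le_rfl)
  | succ n ih =>
    exact .loop_succ (hS _ le_rfl) (hp n (by omega))
      (ih (fun k hk => hS k (by omega)) fun k hk => hp k (by omega))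

theorem ev_clear (a : ℕ) (s : ℕ → ℕ) : Ev (loop a skip) s (update s a 0) := by
  have := Ev.loop_family (a := a) (p := skip) (fun k => update s a k) (s a)
    (fun k _ => by simp) (fun k _ => by
      simp only [update_idem]
      exact .skip _)
  simpa using this

theorem ev_move {a b : ℕ} (hab : a ≠ b) (s : ℕ → ℕ) :
    Ev (loop a (inc b)) s (update (update s a 0) b (s b + s a)) := by
  have := Ev.loop_family (a := a) (p := inc b)
    (fun k => update (update s a k) b (s b + (s a - k))) (s a)
    (fun k _ => by simp [hab]) (fun k hk => by
      refine (Ev.inc _ _).congr ?_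
      funext r
      simp only [update_apply]
      grind)
  simpa using this

theorem ev_move_two {a b c : ℕ} (hab : a ≠ b) (hac : a ≠ c) (hbc : b ≠ c) (s : ℕ → ℕ) :
    Ev (loop a (seq (inc b) (inc c))) s
      (update (update (update s a 0) b (s b + s a)) c (s c + s a)) := by
  have := Ev.loop_family (a := a) (p := seq (inc b) (inc c))
    (fun k => update (update (update s a k) b (s b + (s a - k))) c (s c + (s a - k))) (s a)
    (fun k _ => by simp [hab, hac]) (fun k hk => by
      refine (Ev.seq (Ev.inc _ _) (Ev.inc _ _)).congr ?_
      funext r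
      simp only [update_apply]
      grind)
  simpa using this

/-- Adds register `a` to register `b`, using the cleared register `c`. -/
def copy (a b c : ℕ) : CProg :=
  seq (loop a (seq (inc b) (inc c))) (loop c (inc a))

theorem ev_copy {a b c : ℕ} (hab : a ≠ b) (hac : a ≠ c) (hbc : b ≠ c) {s : ℕ → ℕ}
    (hc : s c = 0) : Ev (copy a b c) s (update s b (s b + s a)) := by
  refine (Ev.seq (ev_move_two hab hac hbc s) (ev_move hac.symm _)).congr ?_
  funext r
  simp only [update_apply]
  grind

/-- `f` is computed by counter programs: for any choice of input registers and an output register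
below `m` there is a program which, started with the output register and all registers from `m` on
cleared, writes the value of `f` into the output register and changes nothing else. -/
def Computes {n : ℕ} (f : List.Vector ℕ n → ℕ) : Prop :=
  ∀ (ins : Fin n → ℕ) (out m : ℕ), (∀ i, ins i < m) → out < m → (∀ i, ins i ≠ out) →
    ∃ p, ∀ s : ℕ → ℕ, (∀ r, m ≤ r → s r = 0) → s out = 0 →
      Ev p s (update s out (f (List.Vector.ofFn fun i => s (ins i))))

theorem computes_get {n : ℕ} (i : Fin n) : Computes fun v : List.Vector ℕ n => v.get i := by
  intro ins out m hins hout hne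
  refine ⟨copy (ins i) out m, fun s hs h0 => ?_⟩
  refine (ev_copy (hne i) (hins i).ne hout.ne (hs m le_rfl)).congr ?_
  simp [h0]

theorem computes_succ : Computes fun v : List.Vector ℕ 1 => v.head.succ := by
  intro ins out m hins hout hne
  refine ⟨seq (copy (ins 0) out m) (inc out), fun s hs h0 => ?_⟩
  refine (Ev.seq (ev_copy (hne 0) (hins 0).ne hout.ne (hs m le_rfl)) (.inc _ _)).congr ?_
  simp [h0]

theorem exists_ev_clear_range (m k : ℕ) :
    ∃ p, ∀ s : ℕ → ℕ, Ev p s fun r => if m ≤ r ∧ r < m + k then 0 else s r := by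
  induction k with
  | zero =>
    refine ⟨skip, fun s => (Ev.skip s).congr ?_⟩
    funext r
    grind
  | succ k ih =>
    obtain ⟨p, hp⟩ := ih
    refine ⟨seq p (loop (m + k) skip), fun s => (Ev.seq (hp s) (ev_clear _ _)).congr ?_⟩
    funext r
    simp only [update_apply]
    grind

theorem exists_ev_range {n k : ℕ} {g : Fin k → List.Vector ℕ n → ℕ} (hg : ∀ i, Computes (g i))
    {ins : Fin n → ℕ} {m : ℕ} (hins : ∀ i, ins i < m) (l : ℕ) (hl : l ≤ k) :
    ∃ p, ∀ s : ℕ → ℕ, (∀ r, m ≤ r → s r = 0) → Ev p s fun r =>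
      if h : m ≤ r ∧ r < m + l then g ⟨r - m, by omega⟩ (List.Vector.ofFn fun i => s (ins i))
      else s r := by
  induction l with
  | zero =>
    refine ⟨skip, fun s _ => (Ev.skip s).congr ?_⟩
    funext r
    grind
  | succ l ih =>
    obtain ⟨p, hp⟩ := ih (by omega)
    obtain ⟨q, hq⟩ := hg ⟨l, hl⟩ ins (m + l) (m + k) (fun i => by have := hins i; omega)
      (by omega) (fun i => by have := hins i; omega)
    refine ⟨seq p q, fun s hs => (Ev.seq (hp s hs) (hq _ ?_ ?_)).congr ?_⟩
    · intro r hr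
      rw [dif_neg (by omega)]
      exact hs r (by omega)
    · rw [dif_neg (by omega)]
      exact hs _ (by omega)
    · have : (fun i => if h : m ≤ ins i ∧ ins i < m + l then
          g ⟨ins i - m, by omega⟩ (List.Vector.ofFn fun i => s (ins i)) else s (ins i))
          = fun i => s (ins i) := by
        funext i
        have := hins i
        rw [dif_neg (by omega)]
      rw [this]
      funext r
      rw [update_apply]
      by_cases hr : r = m + l
      · subst hr
        simp
      · rw [if_neg hr]
        by_cases h : m ≤ r ∧ r < m + l
        · rw [dif_pos h, dif_pos (by omega)]
        · rw [dif_neg h, dif_neg (by omega)]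

theorem Computes.comp {n k : ℕ} {f : List.Vector ℕ k → ℕ} {g : Fin k → List.Vector ℕ n → ℕ}
    (hf : Computes f) (hg : ∀ i, Computes (g i)) :
    Computes fun v => f (List.Vector.ofFn fun i => g i v) := by
  intro ins out m hins hout hne
  obtain ⟨p, hp⟩ := exists_ev_range hg hins k le_rfl
  obtain ⟨q, hq⟩ := hf (fun i => m + i) out (m + k) (fun i => by omega) (by omega)
    (fun i => by omega)
  obtain ⟨c, hc⟩ := exists_ev_clear_range m k
  refine ⟨seq p (seq q c), fun s hs h0 =>
    (Ev.seq (hp s hs) (Ev.seq (hq _ ?_ ?_) (hc _))).congr ?_⟩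
  · intro r hr
    rw [dif_neg (by omega)]
    exact hs r (by omega)
  · rw [dif_neg (by omega)]
    exact h0
  · funext r
    by_cases hr : m ≤ r ∧ r < m + k
    · rw [if_pos hr, update_of_ne (by omega), hs r hr.1]
    · rw [if_neg hr]
      by_cases ho : r = out
      · subst ho
        simp
      · rw [update_of_ne ho, update_of_ne ho, dif_neg hr]

theorem Computes.prec {n : ℕ} {f : List.Vector ℕ n → ℕ} {g : List.Vector ℕ (n + 2) → ℕ}
    (hf : Computes f) (hg : Computes g) :
    Computes fun v : List.Vector ℕ (n + 1) =>
      v.head.rec (f v.tail) fun y IH => g (y ::ᵥ IH ::ᵥ v.tail) := by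
  intro ins out m hins hout hne
  obtain ⟨p, hp⟩ := hf (fun i => ins i.succ) (m + 1) (m + 4)
    (fun i => by have := hins i.succ; omega) (by omega) (fun i => by have := hins i.succ; omega)
  obtain ⟨q, hq⟩ := hg (Fin.cons m (Fin.cons (m + 1) fun i => ins i.succ)) (m + 3) (m + 4)
    (fun i => by
      refine Fin.cases ?_ (fun i => Fin.cases ?_ (fun i => ?_) i) i
      · simp
      · simp
      · simpa using (hins i.succ).trans (by omega)) (by omega)
    (fun i => by
      refine Fin.cases ?_ (fun i => Fin.cases ?_ (fun i => ?_) i) i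
      · simp
      · simp
      · simpa using ((hins i.succ).trans (by omega)).ne)
  -- `m` counts the iterations, `m + 1` accumulates, `m + 2` is the number of remaining iterations
  refine ⟨seq (copy (ins 0) (m + 2) m) (seq p (seq (loop (m + 2)
    (seq q (seq (loop (m + 1) skip) (seq (loop (m + 3) (inc (m + 1))) (inc m)))))
    (seq (loop (m + 1) (inc out)) (loop m skip)))), fun s hs h0 => ?_⟩
  have h00 := hins 0
  have hs0 := hs m le_rfl
  have hs1 := hs (m + 1) (by omega)
  have hs2 := hs (m + 2) (by omega)
  have hs3 := hs (m + 3) (by omega)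
  set t := List.Vector.ofFn fun i : Fin n => s (ins i.succ) with ht
  let F : ℕ → ℕ := fun k => Nat.rec (f t) (fun y IH => g (y ::ᵥ IH ::ᵥ t)) k
  let N := s (ins 0)
  let S : ℕ → ℕ → ℕ := fun k =>
    update (update (update s m (N - k)) (m + 1) (F (N - k))) (m + 2) k
  have hloop : Ev (loop (m + 2)
      (seq q (seq (loop (m + 1) skip) (seq (loop (m + 3) (inc (m + 1))) (inc m)))))
      (S N) (S 0) := by
    refine Ev.loop_family S N (fun k _ => by simp [S]) fun k hk => ?_
    refine (Ev.seq (hq _ ?_ ?_) (Ev.seq (ev_clear _ _)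
      (Ev.seq (ev_move (by omega) _) (.inc _ _)))).congr ?_
    · intro r hr
      simp only [S, update_apply]
      rw [if_neg (by omega), if_neg (by omega), if_neg (by omega), if_neg (by omega)]
      exact hs r (by omega)
    · simp [S, hs3]
    · have hv : (List.Vector.ofFn fun i => update (S (k + 1)) (m + 2) k
          ((Fin.cons m (Fin.cons (m + 1) fun i => ins i.succ) : Fin (n + 2) → ℕ) i))
          = (N - (k + 1)) ::ᵥ F (N - (k + 1)) ::ᵥ t := by
        rw [List.Vector.ofFn, List.Vector.ofFn]
        congr 1
        · simp [S]
        congr 1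
        · simp [S]
        · rw [ht]
          congr 1
          funext i
          have := hins i.succ
          simp only [Fin.cons_succ, S, update_apply]
          rw [if_neg (by omega), if_neg (by omega), if_neg (by omega), if_neg (by omega)]
      rw [hv]
      have hF : F (N - k) = g ((N - (k + 1)) ::ᵥ F (N - (k + 1)) ::ᵥ t) := by
        have : N - k = (N - (k + 1)) + 1 := by omega
        rw [this]
      rw [← hF]
      funext r
      simp only [S, update_apply]
      grind
  have hstart : update (update s (m + 2) (s (m + 2) + s (ins 0))) (m + 1) (f t) = S N := by
    funext r
    have hF : F 0 = f t := rfl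
    simp only [S, update_apply, Nat.sub_self, hF]
    grind
  refine (Ev.seq (ev_copy (by omega) (by omega) (by omega) hs0) (Ev.seq
    ((hp _ ?_ ?_).congr (t' := S N) ?_) (Ev.seq hloop
    (Ev.seq (ev_move (by omega) _) (ev_clear _ _))))).congr ?_
  · intro r hr
    rw [update_of_ne (by omega)]
    exact hs r (by omega)
  · simp [hs1]
  · rw [← hstart]
    congr 2
    rw [ht]
    congr 1
    funext i
    have := hins i.succ
    rw [update_of_ne (by omega)]
  · have hF : (Nat.rec (f (List.Vector.ofFn fun i => s (ins i)).tail)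
        (fun y IH => g (y ::ᵥ IH ::ᵥ (List.Vector.ofFn fun i => s (ins i)).tail))
        (List.Vector.ofFn fun i => s (ins i)).head : ℕ) = F N := by
      simp [F, N, ht, List.Vector.ofFn]
    beta_reduce
    rw [hF]
    funext r
    simp only [S, update_apply, Nat.sub_zero]
    grind

theorem computes_of_primrec' {n : ℕ} {f : List.Vector ℕ n → ℕ} (hf : Nat.Primrec' f) :
    Computes f := by
  induction hf with
  | zero =>
    intro ins out m _ _ _
    refine ⟨skip, fun s _ h0 => (Ev.skip s).congr ?_⟩
    simp [← h0]
  | succ => exact computes_succ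
  | get i => exact computes_get i
  | comp g _ _ ihf ihg => exact ihf.comp ihg
  | prec _ _ ihf ihg => exact ihf.prec ihg

/-- Unbounded search for a zero of a binary primitive recursive function. -/
theorem exists_search {f : ℕ → ℕ → ℕ} (hf : Primrec₂ f) :
    ∃ p, ∀ x, (∃ s', Ev p (Pi.single 0 x) s') ↔ ∃ k, f x k = 0 := by
  obtain ⟨q, hq⟩ := computes_of_primrec' (Nat.Primrec'.prim_iff₂.2 hf) ![0, 1] 2 3
    (by decide) (by decide) (by decide)
  let S : ℕ → ℕ → ℕ → ℕ := fun x k => update (update (Pi.single 0 x) 1 k) 2 (f x k)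
  have hq' : ∀ x k, Ev q (update (Pi.single 0 x) 1 k) (S x k) := by
    intro x k
    refine (hq _ (fun r hr => ?_) (by simp)).congr ?_
    · rw [update_of_ne (by omega), Pi.single_eq_of_ne (by omega)]
    · simp [S, List.Vector.ofFn]
  let body := seq (loop 2 skip) (seq (inc 1) q)
  have hbody : ∀ x k n, Ev body (update (S x k) 2 n) (S x (k + 1)) := by
    intro x k n
    refine Ev.seq (ev_clear _ _) (Ev.seq ((Ev.inc _ _).congr ?_) (hq' x (k + 1)))
    funext r
    simp only [S, update_apply, Pi.single_apply]
    grind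
  refine ⟨seq q (loop 2 body), fun x => ?_⟩
  have hinit : Ev q (Pi.single 0 x) (S x 0) := by
    have h := hq' x 0
    rwa [show update (Pi.single 0 x) 1 0 = (Pi.single 0 x : ℕ → ℕ) by
      rw [update_eq_self_iff]; simp] at h
  constructor
  · rintro ⟨s', h⟩
    cases h with
    | seq h₁ h₂ =>
      rw [h₁.deterministic hinit] at h₂
      by_contra! hne
      suffices ∀ p s t, Ev p s t → p = loop 2 body → ∀ k, s = S x k → False from
        this _ _ _ h₂ rfl 0 rfl
      intro p s t h
      induction h with
      | loop_zero h =>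
        rintro e k rfl
        cases e
        exact hne k (by simpa [S] using h)
      | loop_succ e₁ h₁ _ _ ih =>
        rintro e k rfl
        cases e
        exact ih rfl (k + 1) (h₁.deterministic (hbody x k _))
      | _ => intro e; cases e
  · rintro ⟨k, hk⟩
    suffices ∀ d j, j + d = k → ∃ s', Ev (loop 2 body) (S x j) s' by
      obtain ⟨s', hs'⟩ := this k 0 (by omega)
      exact ⟨s', .seq hinit hs'⟩
    intro d
    induction d with
    | zero =>
      rintro j rfl
      exact ⟨_, .loop_zero (by simpa [S] using hk)⟩
    | succ d ih =>
      intro j hj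
      by_cases h : S x j 2 = 0
      · exact ⟨_, .loop_zero h⟩
      · obtain ⟨n, hn⟩ := Nat.exists_eq_succ_of_ne_zero h
        obtain ⟨s', hs'⟩ := ih (j + 1) (by omega)
        exact ⟨s', .loop_succ hn (hbody x j n) hs'⟩

end CProg


/-! ### Counter machines -/

/-- Instructions of a counter machine with locations `Q`; `jz a q₀ q₁` jumps to `q₀` if register
`a` is zero, and otherwise decrements it and jumps to `q₁`. -/
inductive CInstr (Q : Type)
  | halt
  | jump (q : Q)
  | inc (a : ℕ) (q : Q)
  | jz (a : ℕ) (q₀ q₁ : Q)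

namespace CInstr

open Function

/-- Renaming of locations. -/
def map {Q Q' : Type} (φ : Q → Q') : CInstr Q → CInstr Q'
  | halt => halt
  | jump q => jump (φ q)
  | inc a q => inc a (φ q)
  | jz a q₀ q₁ => jz a (φ q₀) (φ q₁)

/-- All registers of the instruction are below `R`. -/
def Bounded {Q : Type} (R : ℕ) : CInstr Q → Prop
  | halt => True
  | jump _ => True
  | inc a _ => a < R
  | jz a _ _ => a < R

theorem Bounded.mono {Q : Type} {R R' : ℕ} (h : R ≤ R') {i : CInstr Q} (hi : i.Bounded R) :
    i.Bounded R' := by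
  cases i <;> simp only [Bounded] at * <;> omega

theorem exists_bounded {Q : Type} (i : CInstr Q) : ∃ R, i.Bounded R := by
  cases i with
  | halt => exact ⟨0, trivial⟩
  | jump q => exact ⟨0, trivial⟩
  | inc a q => exact ⟨a + 1, Nat.lt_succ_self a⟩
  | jz a q₀ q₁ => exact ⟨a + 1, Nat.lt_succ_self a⟩

/-- The machine `code` halts from location `q` with register contents `s`. -/
inductive Halts {Q : Type} (code : Q → CInstr Q) : Q → (ℕ → ℕ) → Prop
  | halt {q s} : code q = halt → Halts code q s
  | jump {q q' s} : code q = jump q' → Halts code q' s → Halts code q s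
  | inc {q a q' s} : code q = inc a q' → Halts code q' (update s a (s a + 1)) → Halts code q s
  | jz_zero {q a q₀ q₁ s} : code q = jz a q₀ q₁ → s a = 0 → Halts code q₀ s → Halts code q s
  | jz_succ {q a q₀ q₁ s n} : code q = jz a q₀ q₁ → s a = n + 1 →
      Halts code q₁ (update s a n) → Halts code q s

theorem halts_map {Q Q' : Type} {code : Q → CInstr Q} {code' : Q' → CInstr Q'} (φ : Q' → Q)
    (h : ∀ q, code (φ q) = (code' q).map φ) (q : Q') (s : ℕ → ℕ) :
    Halts code' q s ↔ Halts code (φ q) s := by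
  constructor
  · intro H
    induction H with
    | halt e => exact .halt (by rw [h, e]; rfl)
    | jump e _ ih => exact .jump (by rw [h, e]; rfl) ih
    | inc e _ ih => exact .inc (by rw [h, e]; rfl) ih
    | jz_zero e h0 _ ih => exact .jz_zero (by rw [h, e]; rfl) h0 ih
    | jz_succ e h0 _ ih => exact .jz_succ (by rw [h, e]; rfl) h0 ih
  · intro H
    generalize hp : φ q = p at H
    induction H generalizing q with
    | halt e =>
      subst hp
      rw [h] at e
      cases e' : code' q <;> rw [e'] at e <;> cases e
      exact .halt e'
    | jump e _ ih =>
      subst hp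
      rw [h] at e
      cases e' : code' q <;> rw [e'] at e <;> cases e
      exact .jump e' (ih _ rfl)
    | inc e _ ih =>
      subst hp
      rw [h] at e
      cases e' : code' q <;> rw [e'] at e <;> cases e
      exact .inc e' (ih _ rfl)
    | jz_zero e h0 _ ih =>
      subst hp
      rw [h] at e
      cases e' : code' q <;> rw [e'] at e <;> cases e
      exact .jz_zero e' h0 (ih _ rfl)
    | jz_succ e h0 _ ih =>
      subst hp
      rw [h] at e
      cases e' : code' q <;> rw [e'] at e <;> cases e
      exact .jz_succ e' h0 (ih _ rfl)

end CInstr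

namespace CProg

/-- The machine running a stack of programs. -/
def stackCode : List CProg → CInstr (List CProg)
  | [] => .halt
  | skip :: K => .jump K
  | inc a :: K => .inc a K
  | seq p q :: K => .jump (p :: q :: K)
  | loop a p :: K => .jz a K (p :: loop a p :: K)

theorem Ev.halts {p : CProg} {s s' : ℕ → ℕ} (h : Ev p s s') {K : List CProg}
    (hK : CInstr.Halts stackCode K s') : CInstr.Halts stackCode (p :: K) s := by
  induction h generalizing K with
  | skip s => exact .jump rfl hK
  | inc a s => exact .inc rfl hK
  | seq _ _ ih₁ ih₂ => exact .jump rfl (ih₁ (ih₂ hK))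
  | loop_zero h => exact .jz_zero rfl h hK
  | loop_succ h _ _ ih₁ ih₂ => exact .jz_succ rfl h (ih₁ (ih₂ hK))

/-- Big-step termination of a stack of programs. -/
def Terminates : List CProg → (ℕ → ℕ) → Prop
  | [], _ => True
  | p :: K, s => ∃ s', Ev p s s' ∧ Terminates K s'

theorem terminates_of_halts {K : List CProg} {s : ℕ → ℕ} (h : CInstr.Halts stackCode K s) :
    Terminates K s := by
  induction h with
  | @halt K s e =>
    rcases K with _ | ⟨_ | _ | _ | _, K⟩ <;> cases e
    trivial
  | @jump K K' s e _ ih =>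
    rcases K with _ | ⟨_ | _ | _ | _, K⟩ <;> cases e
    · exact ⟨_, .skip s, ih⟩
    · obtain ⟨s', h₁, s'', h₂, h₃⟩ := ih
      exact ⟨s'', .seq h₁ h₂, h₃⟩
  | @inc K a K' s e _ ih =>
    rcases K with _ | ⟨_ | _ | _ | _, K⟩ <;> cases e
    exact ⟨_, .inc a s, ih⟩
  | @jz_zero K a K₀ K₁ s e h0 _ ih =>
    rcases K with _ | ⟨_ | _ | _ | _, K⟩ <;> cases e
    exact ⟨_, .loop_zero h0, ih⟩
  | @jz_succ K a K₀ K₁ s n e h0 _ ih =>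
    rcases K with _ | ⟨_ | _ | _ | _, K⟩ <;> cases e
    obtain ⟨s', h₁, s'', h₂, h₃⟩ := ih
    exact ⟨s'', .loop_succ h0 h₁ h₂, h₃⟩

theorem halts_singleton_iff (p : CProg) (s : ℕ → ℕ) :
    CInstr.Halts stackCode [p] s ↔ ∃ s', Ev p s s' :=
  ⟨fun h => let ⟨s', h, _⟩ := terminates_of_halts h; ⟨s', h⟩, fun ⟨_, h⟩ => h.halts (.halt rfl)⟩

/-- The stacks that occur while running `p` on top of `K`. -/
def stackSet : CProg → List CProg → Set (List CProg)
  | skip, K => {skip :: K}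
  | inc a, K => {inc a :: K}
  | seq p q, K => {seq p q :: K} ∪ stackSet p (q :: K) ∪ stackSet q K
  | loop a p, K => {loop a p :: K} ∪ stackSet p (loop a p :: K)

theorem stackSet_finite (p : CProg) (K : List CProg) : (stackSet p K).Finite := by
  induction p generalizing K with
  | skip => exact Set.finite_singleton _
  | inc a => exact Set.finite_singleton _
  | seq p q ihp ihq => exact ((Set.finite_singleton _).union (ihp _)).union (ihq _)
  | loop a p ih => exact (Set.finite_singleton _).union (ih _)

theorem cons_mem_stackSet (p : CProg) (K : List CProg) : p :: K ∈ stackSet p K := by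
  cases p <;> simp [stackSet]

theorem stackCode_stackSet {S : Set (List CProg)} (p : CProg) (K : List CProg) (hK : K ∈ S)
    (hS : stackSet p K ⊆ S) {L : List CProg} (hL : L ∈ stackSet p K) :
    ∃ i : CInstr S, stackCode L = i.map Subtype.val := by
  induction p generalizing K with
  | skip =>
    obtain rfl : L = skip :: K := hL
    exact ⟨.jump ⟨K, hK⟩, rfl⟩
  | inc a =>
    obtain rfl : L = inc a :: K := hL
    exact ⟨.inc a ⟨K, hK⟩, rfl⟩
  | seq p q ihp ihq =>
    have hp : stackSet p (q :: K) ⊆ S := fun _ h => hS (Or.inl (Or.inr h))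
    have hq : stackSet q K ⊆ S := fun _ h => hS (Or.inr h)
    rcases hL with (rfl | hL) | hL
    · exact ⟨.jump ⟨p :: q :: K, hp (cons_mem_stackSet _ _)⟩, rfl⟩
    · exact ihp _ (hq (cons_mem_stackSet _ _)) hp hL
    · exact ihq _ hK hq hL
  | loop a p ih =>
    have hp : stackSet p (loop a p :: K) ⊆ S := fun _ h => hS (Or.inr h)
    rcases hL with rfl | hL
    · exact ⟨.jz a ⟨K, hK⟩ ⟨p :: loop a p :: K, hp (cons_mem_stackSet _ _)⟩, rfl⟩
    · exact ih _ (hS (cons_mem_stackSet _ _)) hp hL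

/-- A program is run by a counter machine with finitely many locations. -/
theorem exists_machine (p : CProg) :
    ∃ (Q : Type) (_ : Finite Q) (code : Q → CInstr Q) (q₀ : Q),
      ∀ s, CInstr.Halts code q₀ s ↔ ∃ s', Ev p s s' := by
  let S : Set (List CProg) := insert [] (stackSet p [])
  have hfin : S.Finite := (stackSet_finite p []).insert _
  have hex : ∀ L : S, ∃ i : CInstr S, stackCode L = i.map Subtype.val := by
    rintro ⟨L, rfl | hL⟩
    · exact ⟨.halt, rfl⟩
    · exact stackCode_stackSet p [] (Set.mem_insert _ _) (Set.subset_insert _ _) hL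
  choose code hcode using hex
  refine ⟨S, hfin.to_subtype, code, ⟨[p], Set.mem_insert_of_mem _ (cons_mem_stackSet _ _)⟩,
    fun s => ?_⟩
  rw [CInstr.halts_map Subtype.val hcode, halts_singleton_iff]

end CProg

/-- A single counter machine whose halting problem is that of partial recursive codes. -/
theorem exists_universal_machine :
    ∃ (Q : Type) (_ : Finite Q) (code : Q → CInstr Q) (q₀ : Q) (R : ℕ),
      0 < R ∧ (∀ q, (code q).Bounded R) ∧ ∀ x, CInstr.Halts code q₀ (Pi.single 0 x) ↔
        ((Denumerable.ofNat Nat.Partrec.Code x).eval 0).Dom := by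
  let f : ℕ → ℕ → ℕ := fun x k =>
    1 - Encodable.encode (Nat.Partrec.Code.evaln k (Denumerable.ofNat Nat.Partrec.Code x) 0)
  have hf : Primrec₂ f :=
    Primrec.nat_sub.comp (.const 1) (Primrec.encode.comp (Nat.Partrec.Code.primrec_evaln.comp
      (.pair (.pair .snd ((Primrec.ofNat _).comp .fst)) (.const 0))))
  obtain ⟨p, hp⟩ := CProg.exists_search hf
  obtain ⟨Q, hQ, code, q₀, hcode⟩ := CProg.exists_machine p
  choose B hB using fun q => (code q).exists_bounded
  have := Fintype.ofFinite Q
  refine ⟨Q, hQ, code, q₀, Finset.univ.sup B + 1, Nat.succ_pos _,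
    fun q => (hB q).mono ((Finset.le_sup (Finset.mem_univ q)).trans (Nat.le_succ _)),
    fun x => ?_⟩
  rw [hcode, hp, Part.dom_iff_mem]
  simp only [Nat.Partrec.Code.evaln_complete]
  rw [exists_comm]
  refine exists_congr fun k => ?_
  cases h : Nat.Partrec.Code.evaln k (Denumerable.ofNat Nat.Partrec.Code x) 0 <;> simp [f, h]


/-! ### Plays and costs -/

section Plays

variable {V : Type*}

theorem histList_eq_append (π : ℕ → V) (k : ℕ) :
    histList π k = (List.range k).map π ++ [π k] := by
  simp [histList, List.range_succ]

theorem histList_congr {π π' : ℕ → V} {k : ℕ} (h : ∀ j ≤ k, π j = π' j) :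
    histList π k = histList π' k :=
  List.map_congr_left fun j hj => h j (by simpa [Nat.lt_succ_iff] using hj)

theorem chain_histList {E : V → V → Prop} {π : ℕ → V} {k : ℕ}
    (h : ∀ j < k, E (π j) (π (j + 1))) : List.Chain' E ((List.range k).map π ++ [π k]) := by
  rw [← histList_eq_append]
  change List.IsChain _ _
  rw [List.isChain_iff_getElem]
  intro i hi
  simp only [histList, List.length_map, List.length_range] at hi
  simpa [histList] using h i (by omega)

/-- The move prescribed by a strategy along a path is an edge. -/
theorem IsStrategyFor.edge_histList {P : Type*} {E : V → V → Prop} {own : V → P} {i : P}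
    {σ : List V → V} (hσ : IsStrategyFor E own i σ) {π : ℕ → V} {k : ℕ}
    (h : ∀ j < k, E (π j) (π (j + 1))) (hk : own (π k) = i) : E (π k) (σ (histList π k)) := by
  rw [histList_eq_append]
  exact hσ _ _ (chain_histList h) hk

theorem costZ_eq_of_first {w : V → V → ℤ} {T : Set V} {π : ℕ → V} {n : ℕ} (hn : π n ∈ T)
    (hlt : ∀ k < n, π k ∉ T) :
    costZ w T π = ((∑ j ∈ Finset.range n, w (π j) (π (j + 1)) : ℤ) : WithTop ℤ) := by
  have h : ∃ n, π n ∈ T := ⟨n, hn⟩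
  have hf : Nat.find h = n := (Nat.find_eq_iff h).2 ⟨hn, hlt⟩
  rw [costZ, dif_pos h, hf]

/-- There is a strategy of player `0` all of whose fixed Nash equilibrium outcomes have cost at
most `c` for player `0`. -/
def Synthesizable {t : ℕ} (E : V → V → Prop) (own : V → Fin (t + 1))
    (w : Fin (t + 1) → V → V → ℤ) (T : Fin (t + 1) → Set V) (v0 : V) (c : ℕ) : Prop :=
  ∃ σ0 : List V → V, IsStrategyFor E own 0 σ0 ∧
    ∀ (σ : Fin (t + 1) → List V → V) (π : ℕ → V), σ 0 = σ0 → IsNEZ E own w T v0 σ π →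
      costZ (w 0) (T 0) π ≤ ((c : ℤ) : WithTop ℤ)

end Plays

/-! ### The game of a counter machine -/

namespace CheckGame

open Function

/-- Vertices of the game: the vertices `ini` form a chain of exits, one for each checking player;
then player `0` runs the machine, moving on `main`, and claims the results of zero tests, which
player `1` may challenge by moving to `pump`. -/
inductive Vtx (Q : Type) (R : ℕ)
  | ini (j : Fin (2 * R + 1))
  | main (q : Q)
  | claimZero (a : Fin R) (q : Q)
  | claimPos (a : Fin R) (q : Q)
  | pump (j : Fin (2 * R + 1))
  | lost
  | won

instance {Q : Type} [Finite Q] {R : ℕ} : Finite (Vtx Q R) :=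
  Finite.of_surjective (α := Fin (2 * R + 1) ⊕ Q ⊕ (Fin R × Q) ⊕ (Fin R × Q) ⊕
      Fin (2 * R + 1) ⊕ Bool)
    (fun
      | .inl j => .ini j
      | .inr (.inl q) => .main q
      | .inr (.inr (.inl (a, q))) => .claimZero a q
      | .inr (.inr (.inr (.inl (a, q)))) => .claimPos a q
      | .inr (.inr (.inr (.inr (.inl j)))) => .pump j
      | .inr (.inr (.inr (.inr (.inr true)))) => .won
      | .inr (.inr (.inr (.inr (.inr false)))) => .lost)
    (by
      rintro (j | q | ⟨a, q⟩ | ⟨a, q⟩ | j | _ | _)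
      · exact ⟨.inl j, rfl⟩
      · exact ⟨.inr (.inl q), rfl⟩
      · exact ⟨.inr (.inr (.inl (a, q))), rfl⟩
      · exact ⟨.inr (.inr (.inr (.inl (a, q)))), rfl⟩
      · exact ⟨.inr (.inr (.inr (.inr (.inl j)))), rfl⟩
      · exact ⟨.inr (.inr (.inr (.inr (.inr false)))), rfl⟩
      · exact ⟨.inr (.inr (.inr (.inr (.inr true)))), rfl⟩)

section Game

variable {Q : Type} {R : ℕ} (code : Q → CInstr Q) (q₀ : Q) (s₀ : ℕ → ℕ)

/-- Edges of the game. -/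
inductive Edge : Vtx Q R → Vtx Q R → Prop
  | next (j : Fin (2 * R)) : Edge (.ini j.castSucc) (.ini j.succ)
  | leave (j : Fin (2 * R)) : Edge (.ini j.castSucc) .won
  | start : Edge (.ini (Fin.last _)) (.main q₀)
  | halt {q} : code q = .halt → Edge (.main q) (.pump (Fin.last _))
  | jump {q q'} : code q = .jump q' → Edge (.main q) (.main q')
  | inc {q a q'} : code q = .inc a q' → Edge (.main q) (.main q')
  | claimZero {q q₁ q₂} (a : Fin R) : code q = .jz a q₁ q₂ → Edge (.main q) (.claimZero a q₁)
  | claimPos {q q₁ q₂} (a : Fin R) : code q = .jz a q₁ q₂ → Edge (.main q) (.claimPos a q₂)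
  | acceptZero (a q) : Edge (.claimZero a q) (.main q)
  | acceptPos (a q) : Edge (.claimPos a q) (.main q)
  | challengeZero (a q) : Edge (.claimZero a q) (.pump ⟨2 * a, by omega⟩)
  | challengePos (a q) : Edge (.claimPos a q) (.pump ⟨2 * a + 1, by omega⟩)
  | pump (j) : Edge (.pump j) (.pump j)
  | done (j) : Edge (.pump j) .lost
  | lost : Edge .lost .lost
  | won : Edge .won .won

/-- The `i`-th checked quantity: minus register `a` for `i = 2a`, and register `a` for
`i = 2a + 1`. -/
def val (i : ℕ) (s : ℕ → ℕ) : ℤ :=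
  if i % 2 = 0 then -(s (i / 2) : ℤ) else s (i / 2)

theorem val_update_succ (i : ℕ) (s : ℕ → ℕ) (a : ℕ) :
    val i (update s a (s a + 1)) = val i s + val i (Pi.single a 1) := by
  by_cases h : i / 2 = a
  · subst h
    simp only [val, update_self, Pi.single_eq_same]
    split_ifs <;> push_cast <;> ring
  · simp [val, update_of_ne h, Pi.single_eq_of_ne h]

theorem val_update_pred (i : ℕ) {s : ℕ → ℕ} {a n : ℕ} (hn : s a = n + 1) :
    val i (update s a n) = val i s - val i (Pi.single a 1) := by
  have h := val_update_succ i (update s a n) a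
  rw [update_self, update_idem, ← hn, update_eq_self] at h
  omega

/-- The weight of an edge in the `i`-th checked quantity. -/
noncomputable def wt (i : ℕ) : Vtx Q R → Vtx Q R → ℤ
  | .ini _, .won => -1
  | .ini j, .main q => if j = Fin.last _ ∧ q = q₀ then val i s₀ else 0
  | .main q, .main _ => match code q with
    | .inc a _ => val i (Pi.single a 1)
    | _ => 0
  | .claimPos a _, .main _ => -val i (Pi.single (a : ℕ) 1)
  | .claimPos _ _, .pump _ => -1
  | .pump j, .pump _ => if i = j then 0 else -1
  | _, _ => 0

/-- Owners of the vertices. -/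
def own : Vtx Q R → Fin (2 * R + 1 + 1)
  | .ini j => if h : (j : ℕ) < 2 * R then ⟨j + 2, by omega⟩ else 1
  | .main _ => 0
  | _ => 1

/-- Weights of the players. -/
noncomputable def weight (p : Fin (2 * R + 1 + 1)) (u v : Vtx Q R) : ℤ :=
  if (p : ℕ) < 2 then 0 else wt code q₀ s₀ (p - 2) u v

/-- Targets of the players. -/
def target (p : Fin (2 * R + 1 + 1)) : Set (Vtx Q R) :=
  if p = 0 then {.won} else if p = 1 then Set.univ else {.lost, .won}

variable {code q₀ s₀}

theorem exists_edge (hR : ∀ q, (code q).Bounded R) (u : Vtx Q R) : ∃ v, Edge code q₀ u v := by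
  cases u with
  | ini j =>
    refine Fin.lastCases ⟨_, .start⟩ (fun j => ⟨_, .leave j⟩) j
  | main q =>
    have := hR q
    cases h : code q with
    | halt => exact ⟨_, .halt h⟩
    | jump q' => exact ⟨_, .jump h⟩
    | inc a q' => exact ⟨_, .inc h⟩
    | jz a q₁ q₂ =>
      rw [h] at this
      exact ⟨_, .claimZero ⟨a, this⟩ h⟩
  | claimZero a q => exact ⟨_, .acceptZero a q⟩
  | claimPos a q => exact ⟨_, .acceptPos a q⟩
  | pump j => exact ⟨_, .pump j⟩
  | lost => exact ⟨_, .lost⟩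
  | won => exact ⟨_, .won⟩

theorem own_ini_of_lt {j : Fin (2 * R + 1)} (h : (j : ℕ) < 2 * R) :
    own (.ini j : Vtx Q R) = ⟨j + 2, by omega⟩ := dif_pos h

theorem own_eq_zero_iff (u : Vtx Q R) : own u = 0 ↔ ∃ q, u = .main q := by
  cases u with
  | ini j =>
    refine ⟨fun h0 => ?_, fun ⟨q, hq⟩ => nomatch hq⟩
    by_cases h : (j : ℕ) < 2 * R
    · rw [own_ini_of_lt h] at h0
      exact absurd (congrArg Fin.val h0) (Nat.succ_ne_zero _)
    · rw [own, dif_neg h] at h0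
      exact absurd h0 (by simp)
  | _ => simp [own]

theorem exists_ini_of_own {u : Vtx Q R} {p : Fin (2 * R + 1 + 1)} (h0 : p ≠ 0) (h1 : p ≠ 1)
    (h : own u = p) : ∃ j : Fin (2 * R), u = .ini j.castSucc ∧ (p : ℕ) = j + 2 := by
  cases u with
  | ini j =>
    by_cases hj : (j : ℕ) < 2 * R
    · refine ⟨⟨j, hj⟩, rfl, ?_⟩
      rw [own_ini_of_lt hj] at h
      exact (congrArg Fin.val h).symm
    · simp only [own, dif_neg hj] at h
      exact absurd h.symm h1
  | main q => exact absurd h.symm h0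
  | _ => exact absurd h.symm h1

theorem edge_ini {u : Vtx Q R} {j : Fin (2 * R + 1)} (h : Edge code q₀ u (.ini j)) :
    ∃ i : Fin (2 * R + 1), u = .ini i ∧ (j : ℕ) = i + 1 := by
  cases h with
  | next j => exact ⟨_, rfl, by simp⟩

section Play

variable {π : ℕ → Vtx Q R}

theorem index_of_ini (hπ : IsPlay (Edge code q₀) π) (h0 : π 0 = .ini 0) {k : ℕ}
    {j : Fin (2 * R + 1)} (hk : π k = .ini j) : (j : ℕ) = k := by
  induction k generalizing j with
  | zero =>
    rw [h0] at hk
    cases hk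
    rfl
  | succ k ih =>
    obtain ⟨i, hi, hji⟩ := edge_ini (hk ▸ hπ k)
    rw [hji, ih hi]

theorem ini_prefix (hπ : IsPlay (Edge code q₀) π) {k : ℕ} {j : Fin (2 * R + 1)}
    (hk : π k = .ini j) :
    ∀ l ≤ k, ∃ i, π l = .ini i := by
  induction k generalizing j with
  | zero =>
    intro l hl
    obtain rfl : l = 0 := by omega
    exact ⟨j, hk⟩
  | succ k ih =>
    intro l hl
    obtain ⟨i, hi, _⟩ := edge_ini (hk ▸ hπ k)
    rcases Nat.lt_or_ge l (k + 1) with h | h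
    · exact ih hi l (by omega)
    · obtain rfl : l = k + 1 := by omega
      exact ⟨j, hk⟩

/-- Taking an exit costs `-1`. -/
theorem cost_leave (hπ : IsPlay (Edge code q₀) π) {k : ℕ} {j : Fin (2 * R + 1)}
    (hk : π k = .ini j) (hk' : π (k + 1) = .won) (i : ℕ) :
    costZ (wt code q₀ s₀ i) {.lost, .won} π = ((-1 : ℤ) : WithTop ℤ) := by
  have hpre := ini_prefix hπ hk
  rw [costZ_eq_of_first (n := k + 1) (by simp [hk']), Finset.sum_range_succ,
    Finset.sum_eq_zero, hk, hk']
  · simp [wt]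
  · intro l hl
    have hl := Finset.mem_range.1 hl
    obtain ⟨i₁, h₁⟩ := hpre l hl.le
    obtain ⟨i₂, h₂⟩ := hpre (l + 1) hl
    rw [h₁, h₂]
    rfl
  · intro l hl
    obtain ⟨i₁, h₁⟩ := hpre l (by omega)
    simp [h₁]

end Play

theorem target_of_ne {p : Fin (2 * R + 1 + 1)} (h0 : p ≠ 0) (h1 : p ≠ 1) :
    target (Q := Q) p = {.lost, .won} := by
  simp [target, h0, h1]

theorem two_le_of_ne {p : Fin (2 * R + 1 + 1)} (h0 : p ≠ 0) (h1 : p ≠ 1) : 2 ≤ (p : ℕ) := by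
  have h0' : (p : ℕ) ≠ 0 := fun h => h0 (Fin.ext h)
  have h1' : (p : ℕ) ≠ 1 := fun h => h1 (Fin.ext (by simpa using h))
  omega

theorem weight_of_ne {p : Fin (2 * R + 1 + 1)} (h0 : p ≠ 0) (h1 : p ≠ 1) :
    weight code q₀ s₀ p = wt code q₀ s₀ (p - 2) := by
  have := two_le_of_ne h0 h1
  funext u v
  rw [weight, if_neg (by omega)]

/-- A play through the whole chain of exits, consistent with `σ0` and of cost at most `-1` for all
checking players, is the outcome of a fixed Nash equilibrium. -/
theorem exists_isNEZ (hR : ∀ q, (code q).Bounded R) {σ0 : List (Vtx Q R) → Vtx Q R}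
    (hσ0 : IsStrategyFor (Edge code q₀) own 0 σ0) {π : ℕ → Vtx Q R}
    (hπ : IsPlay (Edge code q₀) π)
    (hini : ∀ k (hk : k ≤ 2 * R), π k = .ini ⟨k, by omega⟩)
    (hcons : ∀ k, own (π k) = 0 → π (k + 1) = σ0 (histList π k))
    (hcost : ∀ i < 2 * R,
      costZ (wt code q₀ s₀ i) {.lost, .won} π ≤ ((-1 : ℤ) : WithTop ℤ)) :
    ∃ σ, σ 0 = σ0 ∧
      IsNEZ (Edge code q₀) own (weight code q₀ s₀) target (.ini 0) σ π := by
  choose next hnext using exists_edge (q₀ := q₀) hR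
  let σ : Fin (2 * R + 1 + 1) → List (Vtx Q R) → Vtx Q R := fun i l =>
    if i = 0 then σ0 l else if l = histList π (l.length - 1) then π l.length
    else next (l.getLastD .lost)
  have hσπ : ∀ i ≠ 0, ∀ k, σ i (histList π k) = π (k + 1) := by
    intro i hi k
    have hlen : (histList π k).length = k + 1 := by simp [histList]
    simp [σ, hi, hlen]
  have h0 : π 0 = .ini 0 := hini 0 (by omega)
  refine ⟨σ, by funext l; simp [σ], ?_, hπ, h0, ?_, ?_⟩
  · intro i l u hl hu
    by_cases hi : i = 0
    · subst hi
      simpa [σ] using hσ0 l u hl hu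
    · by_cases h : l ++ [u] = histList π l.length
      · have hul : u = π l.length := by
          rw [histList_eq_append] at h
          simpa using congrArg List.getLast? h
        have e : σ i (l ++ [u]) = π (l.length + 1) := by
          rw [h]
          exact hσπ i hi _
        rw [e, hul]
        exact hπ _
      · simpa [σ, hi, h] using hnext u
  · intro k
    by_cases hk : own (π k) = 0
    · rw [hk, hcons k hk]
      simp [σ]
    · rw [hσπ _ hk]
  · intro p hp τ _ π' hπ' h0' hcons'
    by_cases hp1 : p = 1
    · have huniv : target (Q := Q) p = Set.univ := by simp [target, hp1]
      rw [huniv, costZ_eq_of_first (n := 0) (Set.mem_univ _) (by simp),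
        costZ_eq_of_first (n := 0) (Set.mem_univ _) (by simp)]
      simp
    · have hlt : (p : ℕ) - 2 < 2 * R := by
        have := two_le_of_ne hp hp1
        omega
      rw [target_of_ne hp hp1, weight_of_ne hp hp1]
      by_cases hdev : ∃ k j, π' k = .ini j ∧ π' (k + 1) = .won
      · obtain ⟨k, j, hk, hk'⟩ := hdev
        rw [cost_leave hπ' hk hk']
        exact hcost _ hlt
      · suffices hall : ∀ k, ∀ l ≤ k, π' l = π l by
          rw [show π' = π from funext fun k => hall k k le_rfl]
        intro k
        induction k with
        | zero =>
          intro l hl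
          obtain rfl : l = 0 := by omega
          rw [h0, h0']
        | succ k ih =>
          intro l hl
          rcases Nat.lt_or_ge l (k + 1) with h | h
          · exact ih l (by omega)
          obtain rfl : l = k + 1 := by omega
          by_cases hown : own (π k) = p
          · obtain ⟨j, hj, -⟩ := exists_ini_of_own hp hp1 hown
            have hjk : (j : ℕ) = k := by simpa using index_of_ini hπ h0 hj
            have hj' : π' k = .ini j.castSucc := (ih k le_rfl).trans hj
            have hedge := hπ' k
            rw [hj'] at hedge
            generalize hv : π' (k + 1) = v at hedge
            generalize hu : (Vtx.ini j.castSucc : Vtx Q R) = u at hedge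
            cases hedge with
            | next i =>
              rw [hini (k + 1) (by omega)]
              simp only [Vtx.ini.injEq, Fin.castSucc_inj] at hu
              subst hu
              congr 1
              ext
              simp [hjk]
            | leave i => exact absurd ⟨k, _, hj', hv⟩ hdev
            | start =>
              simp only [Vtx.ini.injEq, Fin.ext_iff, Fin.val_castSucc, Fin.val_last] at hu
              omega
            | _ => cases hu
          · rw [hcons' k, ih k le_rfl, update_of_ne hown, histList_congr ih]
            by_cases hk : own (π k) = 0
            · rw [hk, hcons k hk]
              simp [σ]
            · rw [hσπ _ hk]

end Game

end CheckGame

namespace CheckGame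

open Function

section Refute

variable {Q : Type} {R : ℕ} {code : Q → CInstr Q} {q₀ : Q} {s₀ : ℕ → ℕ}

variable (code q₀ s₀) in
/-- Some path consistent with `σ0` passes through the whole chain of exits and reaches `v` with
accumulated quantities `W`. -/
def Reach (σ0 : List (Vtx Q R) → Vtx Q R) (v : Vtx Q R) (W : ℕ → ℤ) : Prop :=
  ∃ (π : ℕ → Vtx Q R) (n : ℕ), 2 * R ≤ n ∧
    (∀ k (hk : k ≤ 2 * R), π k = .ini ⟨k, by omega⟩) ∧
    (∀ k < n, Edge code q₀ (π k) (π (k + 1)) ∧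
      (own (π k) = 0 → π (k + 1) = σ0 (histList π k)) ∧ π k ≠ .lost ∧ π k ≠ .won) ∧
    π n = v ∧ ∀ i, W i = ∑ k ∈ Finset.range n, wt code q₀ s₀ i (π k) (π (k + 1))

variable {σ0 : List (Vtx Q R) → Vtx Q R}

theorem Reach.step (hσ0 : IsStrategyFor (Edge code q₀) own 0 σ0) {v v' : Vtx Q R} {W : ℕ → ℤ}
    (h : Reach code q₀ s₀ σ0 v W) (hl : v ≠ .lost) (hw : v ≠ .won)
    (he : own v ≠ 0 → Edge code q₀ v v') :
    ∃ v'', Edge code q₀ v v'' ∧ (own v ≠ 0 → v'' = v') ∧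
      Reach code q₀ s₀ σ0 v'' fun i => W i + wt code q₀ s₀ i v v'' := by
  obtain ⟨π, n, hn, hini, hstep, hv, hW⟩ := h
  obtain ⟨v'', hedge, hown, hcons⟩ : ∃ v'', Edge code q₀ v v'' ∧ (own v ≠ 0 → v'' = v') ∧
      (own v = 0 → v'' = σ0 (histList π n)) := by
    by_cases h0 : own v = 0
    · subst hv
      exact ⟨_, hσ0.edge_histList (fun k hk => (hstep k hk).1) h0, fun h => absurd h0 h,
        fun _ => rfl⟩
    · exact ⟨v', he h0, fun _ => rfl, fun h => absurd h h0⟩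
  refine ⟨v'', hedge, hown, fun k => if k ≤ n then π k else v'', n + 1, by omega, ?_, ?_, ?_, ?_⟩
  · intro k hk
    exact (if_pos (by omega)).trans (hini k hk)
  · intro k hk
    have hhist : histList (fun k => if k ≤ n then π k else v'') k = histList π k :=
      histList_congr fun j hj => if_pos (by omega)
    rw [hhist]
    rcases Nat.lt_or_ge k n with h | h
    · simpa [show k ≤ n by omega, show k + 1 ≤ n by omega] using hstep k h
    · obtain rfl : k = n := by omega
      simpa [hv] using ⟨hedge, hcons, hl, hw⟩
  · simp
  · intro i
    beta_reduce
    rw [Finset.sum_range_succ, hW i]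
    congr 1
    · refine Finset.sum_congr rfl fun k hk => ?_
      have := Finset.mem_range.1 hk
      rw [if_pos (by omega), if_pos (by omega)]
    · simp [hv]

/-- A vertex not owned by player `0` can be left along any edge. -/
theorem Reach.move (hσ0 : IsStrategyFor (Edge code q₀) own 0 σ0) {v v' : Vtx Q R} {W W' : ℕ → ℤ}
    (h : Reach code q₀ s₀ σ0 v W) (hl : v ≠ .lost) (hw : v ≠ .won) (ho : own v ≠ 0)
    (he : Edge code q₀ v v') (hW : ∀ i, W' i = W i + wt code q₀ s₀ i v v') :
    Reach code q₀ s₀ σ0 v' W' := by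
  obtain ⟨v'', -, h₁, h₂⟩ := h.step hσ0 hl hw fun _ => he
  obtain rfl := h₁ ho
  rwa [show W' = _ from funext hW]

theorem Reach.pump (hσ0 : IsStrategyFor (Edge code q₀) own 0 σ0) {j : Fin (2 * R + 1)}
    {W : ℕ → ℤ} (h : Reach code q₀ s₀ σ0 (.pump j) W) (N : ℕ) :
    Reach code q₀ s₀ σ0 (.pump j) fun i => W i - if i = j then 0 else (N : ℤ) := by
  induction N with
  | zero => simpa using h
  | succ N ih =>
    refine ih.move hσ0 nofun nofun (by simp [own]) (.pump j) fun i => ?_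
    simp only [wt]
    split_ifs <;> push_cast <;> ring

/-- After a justified challenge, player `1` can make all quantities negative. -/
theorem Reach.exists_lost (hσ0 : IsStrategyFor (Edge code q₀) own 0 σ0) {j : Fin (2 * R + 1)}
    {W : ℕ → ℤ} (h : Reach code q₀ s₀ σ0 (.pump j) W) (hj : (j : ℕ) < 2 * R → W j ≤ -1) :
    ∃ W', Reach code q₀ s₀ σ0 .lost W' ∧ ∀ i < 2 * R, W' i ≤ -1 := by
  refine ⟨_, (h.pump hσ0 (1 + ∑ i ∈ Finset.range (2 * R), (W i).natAbs)).move hσ0 nofun nofun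
    (by simp [own]) (.done j) fun i => rfl, fun i hi => ?_⟩
  have hle : (W i).natAbs ≤ ∑ i ∈ Finset.range (2 * R), (W i).natAbs :=
    Finset.single_le_sum (f := fun i => (W i).natAbs) (fun _ _ => Nat.zero_le _)
      (Finset.mem_range.2 hi)
  simp only [wt]
  split_ifs with h
  · subst h
    have := hj hi
    omega
  · omega

/-- If the machine halts, every strategy of player `0` admits a play reaching `lost` with all
quantities negative: unfaithful simulations are challenged, and the faithful one halts. -/
theorem Reach.exists_lost_of_halts (hσ0 : IsStrategyFor (Edge code q₀) own 0 σ0) {q : Q}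
    {s : ℕ → ℕ} (hs : CInstr.Halts code q s) :
    Reach code q₀ s₀ σ0 (.main q) (fun i => val i s) →
      ∃ W', Reach code q₀ s₀ σ0 .lost W' ∧ ∀ i < 2 * R, W' i ≤ -1 := by
  induction hs with
  | halt hq =>
    intro h
    obtain ⟨v, he, -, hr⟩ := h.step (v' := .lost) hσ0 nofun nofun fun h => absurd rfl h
    cases he with
    | halt _ => exact hr.exists_lost hσ0 fun h => absurd h (by simp)
    | _ => simp_all
  | jump hq _ ih =>
    intro h
    obtain ⟨v, he, -, hr⟩ := h.step (v' := .lost) hσ0 nofun nofun fun h => absurd rfl h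
    cases he with
    | jump h' =>
      rw [hq] at h'
      cases h'
      refine ih ?_
      simpa [wt, hq] using hr
    | _ => simp_all
  | inc hq _ ih =>
    intro h
    obtain ⟨v, he, -, hr⟩ := h.step (v' := .lost) hσ0 nofun nofun fun h => absurd rfl h
    cases he with
    | inc h' =>
      rw [hq] at h'
      cases h'
      refine ih ?_
      simpa [wt, hq, val_update_succ] using hr
    | _ => simp_all
  | jz_zero hq h0 _ ih =>
    intro h
    obtain ⟨v, he, -, hr⟩ := h.step (v' := .lost) hσ0 nofun nofun fun h => absurd rfl h
    cases he with
    | claimZero a h' =>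
      rw [hq] at h'
      cases h'
      exact ih (hr.move hσ0 nofun nofun (by simp [own]) (.acceptZero _ _) (by simp [wt]))
    | claimPos a h' =>
      rw [hq] at h'
      cases h'
      refine (hr.move hσ0 nofun nofun (by simp [own]) (.challengePos _ _) fun _ => rfl).exists_lost
        hσ0 fun _ => ?_
      have : (2 * (a : ℕ) + 1) / 2 = a := by omega
      simp [wt, val, this, h0, Nat.add_mod]
    | _ => simp_all
  | jz_succ hq hn _ ih =>
    intro h
    obtain ⟨v, he, -, hr⟩ := h.step (v' := .lost) hσ0 nofun nofun fun h => absurd rfl h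
    cases he with
    | claimZero a h' =>
      rw [hq] at h'
      cases h'
      refine (hr.move hσ0 nofun nofun (by simp [own]) (.challengeZero _ _) fun _ => rfl).exists_lost
        hσ0 fun _ => ?_
      simp [wt, val, hn]
    | claimPos a h' =>
      rw [hq] at h'
      cases h'
      refine ih (hr.move hσ0 nofun nofun (by simp [own]) (.acceptPos _ _) fun i => ?_)
      simp [wt, val_update_pred i hn]
      ring
    | _ => simp_all

theorem reach_start (σ0 : List (Vtx Q R) → Vtx Q R) :
    Reach code q₀ s₀ σ0 (.main q₀) fun i => val i s₀ := by
  refine ⟨fun k => if hk : k ≤ 2 * R then .ini ⟨k, by omega⟩ else .main q₀, 2 * R + 1, by omega,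
    fun k hk => dif_pos hk, fun k hk => ?_, by simp, fun i => ?_⟩
  · simp only [dif_pos (show k ≤ 2 * R by omega)]
    refine ⟨?_, ?_, nofun, nofun⟩
    · rcases Nat.lt_or_ge k (2 * R) with h | h
      · rw [dif_pos (by omega)]
        exact .next ⟨k, h⟩
      · obtain rfl : k = 2 * R := by omega
        rw [dif_neg (by omega)]
        exact .start
    · intro h
      obtain ⟨q, hq⟩ := (own_eq_zero_iff _).1 h
      cases hq
  · rw [Finset.sum_range_succ, Finset.sum_eq_zero]
    · simp [wt, Fin.ext_iff]
    · intro k hk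
      have := Finset.mem_range.1 hk
      beta_reduce
      rw [dif_pos (by omega), dif_pos (by omega)]
      rfl

theorem not_synthesizable_of_halts (hR : ∀ q, (code q).Bounded R)
    (hs : CInstr.Halts code q₀ s₀) (c : ℕ) :
    ¬ Synthesizable (Edge code q₀) own (weight code q₀ s₀) (target (R := R)) (.ini 0) c := by
  rintro ⟨σ0, hσ0, hall⟩
  obtain ⟨W, ⟨π, n, hn, hini, hstep, hlost, hW⟩, hneg⟩ :=
    Reach.exists_lost_of_halts hσ0 hs (reach_start (s₀ := s₀) σ0)
  let ρ : ℕ → Vtx Q R := fun k => if k ≤ n then π k else .lost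
  have hρ : ∀ k ≤ n, ρ k = π k := fun k hk => if_pos hk
  have hρ' : ∀ k ≥ n, ρ k = .lost := by
    intro k hk
    rcases hk.eq_or_lt with rfl | h
    · rw [hρ _ le_rfl, hlost]
    · exact if_neg (by omega)
  have hplay : IsPlay (Edge code q₀) ρ := by
    intro k
    rcases Nat.lt_or_ge k n with h | h
    · rw [hρ k h.le, hρ (k + 1) h]
      exact (hstep k h).1
    · rw [hρ' k h, hρ' (k + 1) (by omega)]
      exact .lost
  obtain ⟨σ, h0, hne⟩ := exists_isNEZ (s₀ := s₀) hR hσ0 hplay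
    (fun k hk => (hρ k (by omega)).trans (hini k hk))
    (fun k hk => by
      rcases Nat.lt_or_ge k n with h | h
      · rw [hρ k h.le] at hk
        rw [hρ (k + 1) h, (hstep k h).2.1 hk]
        exact congrArg σ0 (histList_congr fun j hj => (hρ j (by omega)).symm)
      · rw [hρ' k h] at hk
        exact absurd hk (by simp [own]))
    (fun i hi => by
      rw [costZ_eq_of_first (n := n) (by simp [hρ' n le_rfl])
        (fun k hk => by simpa [hρ k hk.le] using (hstep k hk).2.2)]
      have := hneg i hi
      rw [hW i] at this
      rw [Finset.sum_congr rfl fun k hk => by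
        rw [hρ k (Finset.mem_range.1 hk).le, hρ (k + 1) (Finset.mem_range.1 hk)]]
      exact_mod_cast this)
  have hcost := hall σ ρ h0 hne
  have hnever : ¬ ∃ k, ρ k ∈ target (0 : Fin (2 * R + 1 + 1)) := by
    rintro ⟨k, hk⟩
    have hk : ρ k = .won := by simpa [target] using hk
    rcases Nat.lt_or_ge k n with h | h
    · exact (hstep k h).2.2.2 (by rw [← hρ k h.le, hk])
    · rw [hρ' k h] at hk
      cases hk
  rw [costZ, dif_neg hnever] at hcost
  simp at hcost

end Refute

end CheckGame

namespace CheckGame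

open Function

section Synthesize

variable {Q : Type} {R : ℕ} {code : Q → CInstr Q} {q₀ : Q} {s₀ : ℕ → ℕ}

variable (code q₀ s₀) in
/-- The `i`-th quantity accumulated along a history. -/
noncomputable def tally (i : ℕ) (l : List (Vtx Q R)) : ℤ :=
  ∑ j ∈ Finset.range (l.length - 1), wt code q₀ s₀ i (l.getD j .lost) (l.getD (j + 1) .lost)

theorem tally_histList (i : ℕ) (π : ℕ → Vtx Q R) (k : ℕ) :
    tally code q₀ s₀ i (histList π k) =
      ∑ j ∈ Finset.range k, wt code q₀ s₀ i (π j) (π (j + 1)) := by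
  have hget : ∀ j ≤ k, (histList π k).getD j .lost = π j := by
    intro j hj
    simp [histList, List.getD, show j < k + 1 by omega]
  rw [tally, show (histList π k).length - 1 = k by simp [histList]]
  refine Finset.sum_congr rfl fun j hj => ?_
  have := Finset.mem_range.1 hj
  rw [hget j (by omega), hget (j + 1) (by omega)]

variable (code q₀ s₀) in
/-- The strategy of player `0` that simulates the machine faithfully. -/
noncomputable def faithful (l : List (Vtx Q R)) : Vtx Q R :=
  match l.getLastD .lost with
  | .main q => match code q with
    | .halt => .pump (Fin.last _)
    | .jump q' => .main q'
    | .inc _ q' => .main q'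
    | .jz a q₁ q₂ =>
      if h : a < R then
        if tally code q₀ s₀ (2 * a + 1) l = 0 then .claimZero ⟨a, h⟩ q₁ else .claimPos ⟨a, h⟩ q₂
      else .lost
  | v => v

theorem isStrategyFor_faithful (hR : ∀ q, (code q).Bounded R) :
    IsStrategyFor (Edge code q₀) (own (R := R)) 0 (faithful code q₀ s₀) := by
  intro l u _ hu
  obtain ⟨q, rfl⟩ := (own_eq_zero_iff u).1 hu
  have hlast : (l ++ [Vtx.main q]).getLastD .lost = .main q := by simp
  have hq := hR q
  unfold faithful
  simp only [hlast]
  split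
  · exact .halt ‹_›
  · exact .jump ‹_›
  · exact .inc ‹_›
  · rename_i a q₁ q₂ h
    rw [h] at hq
    rw [dif_pos (show a < R from hq)]
    split_ifs
    · exact .claimZero ⟨a, hq⟩ h
    · exact .claimPos ⟨a, hq⟩ h

theorem tally_of_claimZero {l : List (Vtx Q R)} {q q' : Q} {a : Fin R}
    (hl : l.getLastD .lost = .main q) (h : faithful code q₀ s₀ l = .claimZero a q') :
    tally code q₀ s₀ (2 * a + 1) l = 0 := by
  unfold faithful at h
  simp only [hl] at h
  split at h
  · cases h
  · cases h
  · cases h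
  · split_ifs at h with h₁ h₂
    cases h
    exact h₂

theorem tally_of_claimPos {l : List (Vtx Q R)} {q q' : Q} {a : Fin R}
    (hl : l.getLastD .lost = .main q) (h : faithful code q₀ s₀ l = .claimPos a q') :
    tally code q₀ s₀ (2 * a + 1) l ≠ 0 := by
  unfold faithful at h
  simp only [hl] at h
  split at h
  · cases h
  · cases h
  · cases h
  · split_ifs at h with h₁ h₂
    cases h
    exact h₂

variable (code) in
/-- What holds at a vertex, with accumulated quantities `W`, along a faithful simulation of a
machine that does not halt. -/
def Invariant : Vtx Q R → (ℕ → ℤ) → Prop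
  | .ini _, W => ∀ i, W i = 0
  | .main q, W => ∃ s, ¬ CInstr.Halts code q s ∧ ∀ i, W i = val i s
  | .claimZero a q, W => ∃ s, s a = 0 ∧ ¬ CInstr.Halts code q s ∧ ∀ i, W i = val i s
  | .claimPos a q, W => ∃ s n, s a = n + 1 ∧ ¬ CInstr.Halts code q (update s a n) ∧
      ∀ i, W i = val i s
  | .pump j, W => (j : ℕ) < 2 * R ∧ 0 ≤ W j
  | .lost, W => ∃ j < 2 * R, 0 ≤ W j
  | .won, _ => True

theorem val_odd (a : ℕ) (s : ℕ → ℕ) : val (2 * a + 1) s = s a := by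
  simp [val, Nat.add_mod, show (2 * a + 1) / 2 = a by omega]

theorem val_even (a : ℕ) (s : ℕ → ℕ) : val (2 * a) s = -s a := by
  simp [val]

theorem Invariant.step (hnot : ¬ CInstr.Halts code q₀ s₀) {u v : Vtx Q R} {W : ℕ → ℤ}
    (hu : Invariant code u W) (he : Edge code q₀ u v)
    (hzero : ∀ a q, v = .claimZero a q → W (2 * a + 1) = 0)
    (hpos : ∀ a q, v = .claimPos a q → W (2 * a + 1) ≠ 0) :
    Invariant code v fun i => W i + wt code q₀ s₀ i u v := by
  cases he with
  | next j => simpa [Invariant, wt] using hu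
  | leave j => trivial
  | start =>
    refine ⟨s₀, hnot, fun i => ?_⟩
    simp [hu i, wt]
  | halt h =>
    obtain ⟨s, hs, -⟩ := hu
    exact absurd (.halt h) hs
  | jump h =>
    obtain ⟨s, hs, hW⟩ := hu
    refine ⟨s, fun h' => hs (.jump h h'), fun i => ?_⟩
    simp [hW, wt, h]
  | inc h =>
    obtain ⟨s, hs, hW⟩ := hu
    refine ⟨_, fun h' => hs (.inc h h'), fun i => ?_⟩
    simp [hW, wt, h, val_update_succ]
  | claimZero a h =>
    obtain ⟨s, hs, hW⟩ := hu
    have h0 : s a = 0 := by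
      have := hzero a _ rfl
      rw [hW, val_odd] at this
      omega
    exact ⟨s, h0, fun h' => hs (.jz_zero h h0 h'), fun i => by simp [hW, wt]⟩
  | claimPos a h =>
    obtain ⟨s, hs, hW⟩ := hu
    obtain ⟨n, hn⟩ : ∃ n, s a = n + 1 := by
      have := hpos a _ rfl
      rw [hW, val_odd] at this
      exact Nat.exists_eq_add_one_of_ne_zero (by omega)
    exact ⟨s, n, hn, fun h' => hs (.jz_succ h hn h'), fun i => by simp [hW, wt]⟩
  | acceptZero a q =>
    obtain ⟨s, -, hs, hW⟩ := hu
    exact ⟨s, hs, fun i => by simp [hW, wt]⟩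
  | acceptPos a q =>
    obtain ⟨s, n, hn, hs, hW⟩ := hu
    refine ⟨_, hs, fun i => ?_⟩
    beta_reduce
    rw [val_update_pred i hn, hW]
    rfl
  | challengeZero a q =>
    obtain ⟨s, h0, -, hW⟩ := hu
    refine ⟨by simp, ?_⟩
    simp [hW, val_even, h0, wt]
  | challengePos a q =>
    obtain ⟨s, n, hn, -, hW⟩ := hu
    refine ⟨by simp; omega, ?_⟩
    simp [hW, val_odd, hn, wt]
  | pump j => exact ⟨hu.1, by simpa [wt] using hu.2⟩
  | done j => exact ⟨j, hu.1, by simpa [wt] using hu.2⟩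
  | lost => simpa [Invariant, wt] using hu
  | won => trivial

theorem invariant_of_faithful (hnot : ¬ CInstr.Halts code q₀ s₀) {π : ℕ → Vtx Q R}
    (hπ : IsPlay (Edge code q₀) π) (h0 : π 0 = .ini 0)
    (hcons : ∀ k, own (π k) = 0 → π (k + 1) = faithful code q₀ s₀ (histList π k)) (k : ℕ) :
    Invariant code (π k) fun i => ∑ j ∈ Finset.range k, wt code q₀ s₀ i (π j) (π (j + 1)) := by
  induction k with
  | zero => simp [h0, Invariant]
  | succ k ih =>
    simp only [Finset.sum_range_succ]
    have hlast : (histList π k).getLastD .lost = π k := by simp [histList_eq_append]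
    refine ih.step hnot (hπ k) (fun a q ha => ?_) (fun a q ha => ?_)
    · have he := hπ k
      rw [ha] at he
      generalize hu : π k = u at he
      cases he
      rw [← tally_histList]
      refine tally_of_claimZero (hlast.trans hu) (q' := q) ?_
      rw [← hcons k (by rw [hu]; rfl), ha]
    · have he := hπ k
      rw [ha] at he
      generalize hu : π k = u at he
      cases he
      rw [← tally_histList]
      refine tally_of_claimPos (hlast.trans hu) (q' := q) ?_
      rw [← hcons k (by rw [hu]; rfl), ha]

theorem ini_of_not_won {π : ℕ → Vtx Q R} (hπ : IsPlay (Edge code q₀) π) (h0 : π 0 = .ini 0)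
    (hwon : ∀ k, π k ≠ .won) (k : ℕ) (hk : k ≤ 2 * R) : π k = .ini ⟨k, by omega⟩ := by
  induction k with
  | zero => exact h0
  | succ k ih =>
    have he := hπ k
    rw [ih (by omega)] at he
    generalize hv : π (k + 1) = v at he
    generalize hu : (Vtx.ini ⟨k, by omega⟩ : Vtx Q R) = u at he
    cases he with
    | next j =>
      simp only [Vtx.ini.injEq, Fin.ext_iff, Fin.val_castSucc] at hu
      congr 1
      ext
      simp [hu]
    | leave j => exact absurd hv (hwon _)
    | start =>
      simp only [Vtx.ini.injEq, Fin.ext_iff, Fin.val_last] at hu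
      omega
    | _ => cases hu

/-- In an equilibrium that never reaches `won`, each checking player has cost at most `-1`, the
cost of taking his exit. -/
theorem cost_le_of_isNEZ {σ : Fin (2 * R + 1 + 1) → List (Vtx Q R) → Vtx Q R}
    {π : ℕ → Vtx Q R}
    (hne : IsNEZ (Edge code q₀) own (weight code q₀ s₀) target (.ini 0) σ π)
    (hini : ∀ k (hk : k ≤ 2 * R), π k = .ini ⟨k, by omega⟩) (j : Fin (2 * R)) :
    costZ (wt code q₀ s₀ j) {.lost, .won} π ≤ ((-1 : ℤ) : WithTop ℤ) := by
  obtain ⟨hσ, hπ, h0, hcons, hne⟩ := hne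
  let p : Fin (2 * R + 1 + 1) := ⟨j + 2, by omega⟩
  have hp0 : p ≠ 0 := fun h => absurd (congrArg Fin.val h) (Nat.succ_ne_zero _)
  have hp1 : p ≠ 1 := fun h => by
    have := congrArg Fin.val h
    simp [p] at this
  have hownj : own (.ini j.castSucc : Vtx Q R) = p := own_ini_of_lt (by simp)
  let τ : List (Vtx Q R) → Vtx Q R := fun l =>
    if l.getLastD .lost = .ini j.castSucc then .won else σ p l
  let ρ : ℕ → Vtx Q R := fun k => if k ≤ (j : ℕ) then π k else .won
  have hρ : ∀ k ≤ (j : ℕ), ρ k = π k := fun k hk => if_pos hk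
  have hρ' : ∀ k, (j : ℕ) < k → ρ k = .won := fun k hk => if_neg (by omega)
  have hπj : π j = .ini j.castSucc := hini j (by omega)
  have hplay : IsPlay (Edge code q₀) ρ := by
    intro k
    rcases lt_trichotomy k (j : ℕ) with h | h | h
    · rw [hρ k h.le, hρ (k + 1) h]
      exact hπ k
    · rw [hρ k h.le, hρ' (k + 1) (by omega), h, hπj]
      exact .leave j
    · rw [hρ' k h, hρ' (k + 1) (by omega)]
      exact .won
  have key := hne p hp0 τ ?_ ρ hplay ((hρ 0 (by omega)).trans h0) ?_
  · rw [target_of_ne hp0 hp1, weight_of_ne hp0 hp1,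
      cost_leave hplay ((hρ j le_rfl).trans hπj) (hρ' _ (by omega))] at key
    exact key
  · intro l u hl hu
    by_cases h : u = .ini j.castSucc
    · subst h
      simpa [τ] using Edge.leave j
    · simpa [τ, h] using hσ p l u hl hu
  · intro k
    rcases lt_trichotomy k (j : ℕ) with h | h | h
    · have hne : own (π k) ≠ p := by
        rw [hini k (by omega), own_ini_of_lt (by simp; omega)]
        simp [p]
        omega
      rw [hρ k h.le, hρ (k + 1) h, update_of_ne hne, hcons k,
        histList_congr fun i hi => hρ i (by omega)]
    · have hlast : (histList ρ k).getLastD .lost = .ini j.castSucc := by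
        simp [histList_eq_append, h, hρ j le_rfl, hπj]
      rw [hρ k h.le, hρ' (k + 1) (by omega), h, hπj, hownj, update_self]
      rw [h] at hlast
      exact (if_pos hlast).symm
    · have hown : own (.won : Vtx Q R) = 1 := rfl
      rw [hρ' k h, hρ' (k + 1) (by omega), hown, update_of_ne hp1.symm]
      have he := (hσ 1).edge_histList (fun i _ => hplay i) (k := k) (by rw [hρ' k h]; rfl)
      rw [hρ' k h] at he
      generalize σ 1 (histList ρ k) = v at he
      cases he
      rfl

theorem synthesizable_of_not_halts (hpos : 0 < R) (hR : ∀ q, (code q).Bounded R)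
    (hnot : ¬ CInstr.Halts code q₀ s₀) :
    Synthesizable (Edge code q₀) own (weight code q₀ s₀) (target (R := R)) (.ini 0) 0 := by
  refine ⟨faithful code q₀ s₀, isStrategyFor_faithful hR, fun σ π hσ0 hne => ?_⟩
  by_cases hwon : ∃ k, π k ∈ target (0 : Fin (2 * R + 1 + 1))
  · rw [costZ, dif_pos hwon]
    simp [weight]
  exfalso
  have hini := ini_of_not_won hne.2.1 hne.2.2.1
    fun k hk => hwon ⟨k, by simpa [target] using hk⟩
  have hcost := cost_le_of_isNEZ hne hini
  have hend : ∃ n, π n ∈ ({.lost, .won} : Set (Vtx Q R)) := by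
    by_contra h
    have := hcost ⟨0, by omega⟩
    rw [costZ, dif_neg h] at this
    simp at this
  obtain ⟨n, hn, hmin⟩ : ∃ n, π n ∈ ({.lost, .won} : Set (Vtx Q R)) ∧
      ∀ k < n, π k ∉ ({.lost, .won} : Set (Vtx Q R)) :=
    ⟨Nat.find hend, Nat.find_spec hend, fun k hk => Nat.find_min hend hk⟩
  have hlost : π n = .lost := by
    rcases hn with h | h
    · exact h
    · exact absurd ⟨_, by simpa [target] using h⟩ hwon
  have hinv := invariant_of_faithful hnot hne.2.1 hne.2.2.1
    (fun k hk => by rw [hne.2.2.2.1 k, hk, hσ0]) n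
  rw [hlost] at hinv
  obtain ⟨j, hj, hge⟩ := hinv
  have := hcost ⟨j, hj⟩
  rw [costZ_eq_of_first hn hmin, WithTop.coe_le_coe] at this
  simp only at this hge
  omega

end Synthesize

end CheckGame

/-! ### Renaming the vertices of a game -/

section Transport

variable {V W : Type*}

theorem map_histList (f : V → W) (π : ℕ → V) (k : ℕ) :
    (histList π k).map f = histList (f ∘ π) k := by
  simp [histList]

theorem costZ_comp (f : V → W) (w : W → W → ℤ) (T : Set W) (π : ℕ → V) :
    costZ (fun u v => w (f u) (f v)) (f ⁻¹' T) π = costZ w T (f ∘ π) := rfl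

variable {t : ℕ} {E : W → W → Prop} {own : W → Fin (t + 1)} {w : Fin (t + 1) → W → W → ℤ}
  {T : Fin (t + 1) → Set W} {v0 : W} {c : ℕ} (e : V ≃ W)

theorem IsStrategyFor.comap {i : Fin (t + 1)} {σ : List W → W} (hσ : IsStrategyFor E own i σ) :
    IsStrategyFor (fun u v => E (e u) (e v)) (fun u => own (e u)) i
      fun l => e.symm (σ (l.map e)) := by
  intro l u hl hu
  have h : List.IsChain E ((l ++ [u]).map e) := (List.isChain_map e).2 hl
  rw [List.map_append] at h
  simpa using hσ (l.map e) (e u) h hu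

theorem IsStrategyFor.map {i : Fin (t + 1)} {σ : List V → V}
    (hσ : IsStrategyFor (fun u v => E (e u) (e v)) (fun u => own (e u)) i σ) :
    IsStrategyFor E own i fun l => e (σ (l.map e.symm)) := by
  simpa using hσ.comap e.symm

theorem IsNEZ.map {σ : Fin (t + 1) → List V → V} {π : ℕ → V}
    (h : IsNEZ (fun u v => E (e u) (e v)) (fun u => own (e u)) (fun i u v => w i (e u) (e v))
      (fun i => e ⁻¹' T i) (e.symm v0) σ π) :
    IsNEZ E own w T v0 (fun i l => e (σ i (l.map e.symm))) (e ∘ π) := by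
  obtain ⟨hσ, hπ, h0, hcons, hne⟩ := h
  refine ⟨fun i => (hσ i).map e, hπ, by simp [h0], fun k => ?_, ?_⟩
  · simp [map_histList, ← Function.comp_assoc, ← hcons k]
  · intro i hi τ hτ ρ hρ hρ0 hρcons
    have key := hne i hi _ (hτ.comap e) (e.symm ∘ ρ) (fun k => by simpa using hρ k)
      (by simp [hρ0]) fun k => ?_
    · rw [costZ_comp, costZ_comp, ← Function.comp_assoc] at key
      simpa using key
    · have hk := hρcons k
      by_cases ho : own (ρ k) = i
      · simp [ho] at hk
        simp [ho, map_histList, ← Function.comp_assoc, hk]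
      · simp [ho] at hk
        simp [ho, hk, map_histList]

theorem Synthesizable.comap (h : Synthesizable E own w T v0 c) :
    Synthesizable (fun u v => E (e u) (e v)) (fun u => own (e u)) (fun i u v => w i (e u) (e v))
      (fun i => e ⁻¹' T i) (e.symm v0) c := by
  obtain ⟨σ0, hσ0, hall⟩ := h
  refine ⟨_, hσ0.comap e, fun σ π hσ hne => ?_⟩
  exact hall _ _ (by simp [hσ]) (hne.map e)

theorem synthesizable_comap_iff :
    Synthesizable (fun u v => E (e u) (e v)) (fun u => own (e u)) (fun i u v => w i (e u) (e v))
      (fun i => e ⁻¹' T i) (e.symm v0) c ↔ Synthesizable E own w T v0 c :=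
  ⟨fun h => by simpa [← Set.preimage_comp] using h.comap e.symm, fun h => h.comap e⟩

end Transport

/-! ### Instances presenting a game -/

namespace NCNSInstance

section OfGame

variable {N t : ℕ} (E : Fin N → Fin N → Prop) (own : Fin N → Fin (t + 1))
  (w : Fin (t + 1) → Fin N → Fin N → ℤ) (T : Fin (t + 1) → Set (Fin N)) (v0 : Fin N)
  (d : Fin (t + 1) → ℤ) (a b : Fin N) (c : ℕ)

/-- The list of weighted edges presenting the weight function of player `i`. -/
noncomputable def weightList (i : Fin (t + 1)) : List (ℕ × ℕ × ℤ) :=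
  (Finset.univ : Finset (Fin N × Fin N)).toList.map fun p => (p.1, p.2, w i p.1 p.2)

/-- An instance presenting the given game, with the weight of the edge from `a` to `b` increased
by `x * d i` for each player `i`. -/
noncomputable def ofGame (x : ℕ) : NCNSInstance where
  n := N
  t := t
  edges := ((Finset.univ : Finset (Fin N × Fin N)).filter fun p => E p.1 p.2).toList.map
    fun p => (p.1, p.2)
  own := List.ofFn fun u => (own u : ℕ)
  w := List.ofFn fun i => (List.cons ((a : ℕ), (b : ℕ), d i))^[x] (weightList w i)
  tgt := List.ofFn fun i => ((Finset.univ : Finset (Fin N)).filter fun v => v ∈ T i).toList.map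
    Fin.val
  v0 := v0
  c := c

theorem edge_ofGame (x : ℕ) : (ofGame E own w T v0 d a b c x).Edge = E := by
  funext u v
  simp only [Edge, ofGame, List.mem_map, Finset.mem_toList, Finset.mem_filter, Finset.mem_univ,
    true_and, Prod.mk.injEq, Prod.exists, eq_iff_iff]
  constructor
  · rintro ⟨u', v', h, hu, hv⟩
    rwa [← Fin.ext hu, ← Fin.ext hv]
  · exact fun h => ⟨u, v, h, rfl, rfl⟩

theorem owner_ofGame (x : ℕ) : (ofGame E own w T v0 d a b c x).owner = own := by
  funext u
  have hu : (u : ℕ) < N := u.isLt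
  ext
  simp only [owner, ofGame, List.getD, List.getElem?_ofFn, hu, dif_pos, Option.getD_some]
  exact Nat.mod_eq_of_lt (own u).isLt

theorem target_ofGame (x : ℕ) : (ofGame E own w T v0 d a b c x).target = T := by
  funext i
  have hi : (i : ℕ) < t + 1 := i.isLt
  ext v
  change (v : ℕ) ∈ (_ : List ℕ) ↔ _
  simp only [ofGame, List.getD, List.getElem?_ofFn, hi, dif_pos, Option.getD_some, List.mem_map,
    Finset.mem_toList, Finset.mem_filter, Finset.mem_univ, true_and]
  constructor
  · rintro ⟨v', h, hv⟩
    rwa [← Fin.ext hv]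
  · exact fun h => ⟨v, h, rfl⟩

theorem sum_map_filter {α : Type*} (l : List α) (P : α → Bool) (f : α → ℤ) :
    ((l.filter P).map f).sum = (l.map fun y => if P y then f y else 0).sum := by
  induction l with
  | nil => rfl
  | cons y l ih => by_cases h : P y <;> simp [h, ih]

theorem sum_weightList (i : Fin (t + 1)) (u v : Fin N) :
    (((weightList w i).filter fun p => p.1 == (u : ℕ) && p.2.1 == (v : ℕ)).map
      fun p => p.2.2).sum = w i u v := by
  rw [sum_map_filter, weightList, List.map_map, Finset.sum_map_toList,
    Finset.sum_eq_single (u, v)]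
  · simp
  · rintro ⟨u', v'⟩ - h
    refine if_neg fun h' => h ?_
    simpa [Fin.ext_iff] using h'
  · simp

theorem weight_ofGame (x : ℕ) (i : Fin (t + 1)) (u v : Fin N) :
    (ofGame E own w T v0 d a b c x).weight i u v =
      w i u v + if u = a ∧ v = b then x * d i else 0 := by
  have hi : (i : ℕ) < t + 1 := i.isLt
  simp only [weight, ofGame, List.getD, List.getElem?_ofFn, hi, dif_pos, Option.getD_some]
  induction x with
  | zero => simpa using sum_weightList w i u v
  | succ x ih =>
    rw [Function.iterate_succ_apply', List.filter_cons]
    by_cases h : u = a ∧ v = b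
    · rw [if_pos h] at ih ⊢
      rw [if_pos (by simp [h.1, h.2]), List.map_cons, List.sum_cons, ih]
      push_cast
      ring
    · rw [if_neg h] at ih ⊢
      rw [if_neg, ih]
      intro h'
      simp only [Bool.and_eq_true, beq_iff_eq] at h'
      exact h ⟨Fin.ext h'.1.symm, Fin.ext h'.2.symm⟩

theorem computable_ofGame : Computable (ofGame E own w T v0 d a b c) := by
  have hw : Primrec fun x : ℕ =>
      List.ofFn fun i => (List.cons ((a : ℕ), (b : ℕ), d i))^[x] (weightList w i) :=
    Primrec.list_ofFn fun i => Primrec.nat_iterate Primrec.id (Primrec.const _)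
      (Primrec.list_cons.comp (Primrec.const _) Primrec.snd)
  exact ((Primrec.of_equiv_symm (e := encEquiv)).comp
    ((Primrec.const _).pair ((Primrec.const _).pair ((Primrec.const _).pair
      ((Primrec.const _).pair (hw.pair ((Primrec.const _).pair
        ((Primrec.const _).pair (Primrec.const _)))))))) :
    Primrec (ofGame E own w T v0 d a b c)).to_comp

end OfGame

end NCNSInstance

/-! ### The reduction -/

namespace CheckGame

section Reduction

variable {Q : Type} {R : ℕ} {code : Q → CInstr Q} {q₀ : Q}

/-- The contribution, for each player, of a unit of input in register `0`. -/
noncomputable def inputWeight (p : Fin (2 * R + 1 + 1)) : ℤ :=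
  if (p : ℕ) < 2 then 0 else val (p - 2) (Pi.single 0 1)

theorem val_single (i x : ℕ) : val i (Pi.single 0 x) = x * val i (Pi.single 0 1) := by
  by_cases h : i / 2 = 0
  · simp [val, h]
  · simp [val, Pi.single_eq_of_ne h]

theorem weight_single (x : ℕ) (p : Fin (2 * R + 1 + 1)) (u v : Vtx Q R) :
    weight code q₀ (Pi.single 0 x) p u v = weight code q₀ 0 p u v +
      if u = .ini (Fin.last _) ∧ v = .main q₀ then x * inputWeight p else 0 := by
  by_cases hp : (p : ℕ) < 2
  · simp [weight, inputWeight, hp]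
  · simp only [weight, inputWeight, if_neg hp]
    cases u with
    | ini j =>
      cases v with
      | main q =>
        by_cases h : j = Fin.last _ ∧ q = q₀
        · have hzero : val (p - 2) 0 = 0 := by simp [val]
          simp only [wt, h.1, h.2, and_self, if_true, hzero, val_single _ x, zero_add]
        · simp [wt, h]
      | _ => simp [wt]
    | main q => cases v <;> simp [wt]
    | claimZero a q => cases v <;> simp [wt]
    | claimPos a q => cases v <;> simp [wt]
    | pump j => cases v <;> simp [wt]
    | lost => cases v <;> simp [wt]
    | won => cases v <;> simp [wt]

/-- Nontermination of a counter machine reduces to the synthesis problem. -/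
theorem not_halts_manyOneReducible [Finite Q] (hpos : 0 < R) (hR : ∀ q, (code q).Bounded R) :
    (fun x : ℕ => ¬ CInstr.Halts code q₀ (Pi.single 0 x)) ≤₀ NCNSInstance.Positive := by
  let e : Fin (Nat.card (Vtx Q R)) ≃ Vtx Q R := (Finite.equivFin _).symm
  refine ⟨NCNSInstance.ofGame (fun u v => Edge code q₀ (e u) (e v)) (fun u => own (e u))
    (fun i u v => weight code q₀ 0 i (e u) (e v)) (fun i => e ⁻¹' target i) (e.symm (.ini 0))
    inputWeight (e.symm (.ini (Fin.last _))) (e.symm (.main q₀)) 0,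
    NCNSInstance.computable_ofGame .., fun x => ?_⟩
  set I := NCNSInstance.ofGame (fun u v => Edge code q₀ (e u) (e v)) (fun u => own (e u))
    (fun i u v => weight code q₀ 0 i (e u) (e v)) (fun i => e ⁻¹' target i) (e.symm (.ini 0))
    inputWeight (e.symm (.ini (Fin.last _))) (e.symm (.main q₀)) 0 x
  have hE : I.Edge = fun u v => Edge code q₀ (e u) (e v) := NCNSInstance.edge_ofGame ..
  have hw : I.weight = fun i u v => weight code q₀ (Pi.single 0 x) i (e u) (e v) := by
    refine funext fun (i : Fin (2 * R + 1 + 1)) => funext fun (u : Fin (Nat.card (Vtx Q R))) =>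
      funext fun (v : Fin (Nat.card (Vtx Q R))) => ?_
    refine (NCNSInstance.weight_ofGame ..).trans (Eq.trans ?_ (weight_single x i _ _).symm)
    simp only [Equiv.eq_symm_apply]
  have hiff : Synthesizable I.Edge I.owner I.weight I.target (e.symm (.ini 0)) 0 ↔
      ¬ CInstr.Halts code q₀ (Pi.single 0 x) := by
    rw [hE, hw, show I.owner = _ from NCNSInstance.owner_ofGame ..,
      show I.target = _ from NCNSInstance.target_ofGame ..]
    refine (synthesizable_comap_iff e).trans ?_
    exact ⟨fun h hs => not_synthesizable_of_halts hR hs _ h, synthesizable_of_not_halts hpos hR⟩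
  refine hiff.symm.trans ⟨fun h => ⟨(e.symm (.ini 0)).isLt, fun u => ?_, h⟩, fun ⟨_, _, h⟩ => h⟩
  obtain ⟨v, hv⟩ := exists_edge (q₀ := q₀) hR (e u)
  refine ⟨e.symm v, ?_⟩
  rw [hE]
  simpa using hv

end Reduction

end CheckGame

/-- The non-cooperative Nash rational synthesis problem for quantitative reachability
games with integer weights is undecidable: the set of positive instances is not a
computable (decidable) set. -/
theorem NCNS_undecidable : ¬ ComputablePred NCNSInstance.Positive := by
  intro h
  obtain ⟨Q, _, code, q₀, R, hpos, hR, hcode⟩ := exists_universal_machine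
  have hnot := ComputablePred.computable_of_manyOneReducible
    (CheckGame.not_halts_manyOneReducible (q₀ := q₀) hpos hR) h
  have hred : (fun c : Nat.Partrec.Code => (c.eval 0).Dom) ≤₀
      fun x : ℕ => ¬ ¬ CInstr.Halts code q₀ (Pi.single 0 x) :=
    ⟨Encodable.encode, Computable.encode, fun c => by
      beta_reduce
      rw [not_not, hcode, Denumerable.ofNat_encode]⟩
  exact ComputablePred.halting_problem 0
    (ComputablePred.computable_of_manyOneReducible hred hnot.not)
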